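/- arXiv:2410.13777 — 7 statements merged into one kernel-verified Lean document; each statement's English description precedes it below -/
import Mathlib

section
/- Let I ⊆ ℝ be an interval, let γ : I × ℝ → ℝ², (τ,s) ↦ γ(τ,s), be continuously differentiable, let q ≥ 3 be an integer, τ₀ ∈ I, and let t₀, …, t_{q−1} ∈ ℝ (indices taken mod q) be such that for every k, ∂ₛγ(τ₀,t_k) ≠ 0 and there exists α_k > 0 with γ(τ₀, t_{k+1}) − γ(τ₀, t_{k−1}) = α_k · ∂ₛγ(τ₀, t_k) (the symplectic reflection law). Then the derivative at τ = τ₀ of the action τ ↦ Σ_{k=0}^{q−1} ω(γ(τ,t_k), γ(τ,t_{k+1})) equals Σ_{k=0}^{q−1} ω(∂_τγ(τ₀,t_k), ∂ₛγ(τ₀,t_k)) · ‖γ(τ₀,t_{k+1}) − γ(τ₀,t_{k−1})‖ / ‖∂ₛγ(τ₀,t_k)‖; equivalently, α_k = ‖γ(τ₀,t_{k+1}) − γ(τ₀,t_{k−1})‖ / ‖∂ₛγ(τ₀,t_k)‖ and the derivative equals Σ_k ω(∂_τγ(τ₀,t_k), ∂ₛγ(τ₀,t_k)) α_k. -/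
open Real

/-- The standard area form on the plane: determinant of the matrix with columns `u`, `v`. -/
noncomputable def omega (u v : EuclideanSpace ℝ (Fin 2)) : ℝ := u 0 * v 1 - u 1 * v 0

theorem omega_sub_right (u v w : EuclideanSpace ℝ (Fin 2)) :
    omega u (v - w) = omega u v - omega u w := by
  simp only [omega, PiLp.sub_apply]
  ring

theorem omega_smul_right (u v : EuclideanSpace ℝ (Fin 2)) (c : ℝ) :
    omega u (c • v) = omega u v * c := by
  simp only [omega, PiLp.smul_apply, smul_eq_mul]
  ring

theorem omega_antisymm (u v : EuclideanSpace ℝ (Fin 2)) : omega u v = -omega v u := by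
  simp only [omega]
  ring

theorem HasDerivAt.omega_apply {f g : ℝ → EuclideanSpace ℝ (Fin 2)}
    {f' g' : EuclideanSpace ℝ (Fin 2)} {x : ℝ} (hf : HasDerivAt f f' x) (hg : HasDerivAt g g' x) :
    HasDerivAt (fun y => omega (f y) (g y)) (omega f' (g x) + omega (f x) g') x := by
  have hcoord {h : ℝ → EuclideanSpace ℝ (Fin 2)} {h' : EuclideanSpace ℝ (Fin 2)}
      (hh : HasDerivAt h h' x) (i : Fin 2) : HasDerivAt (fun y => h y i) (h' i) x :=
    (EuclideanSpace.proj (𝕜 := ℝ) i).hasFDerivAt.comp_hasDerivAt x hh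
  refine (((hcoord hf 0).mul (hcoord hg 1)).sub
    ((hcoord hf 1).mul (hcoord hg 0))).congr_deriv ?_
  simp only [omega]
  ring

/-- Discrete summation by parts for the area form around a closed polygon. -/
theorem sum_omega_add_omega {q : ℕ} [NeZero q] (u v : ZMod q → EuclideanSpace ℝ (Fin 2)) :
    ∑ k, (omega (v k) (u (k + 1)) + omega (u k) (v (k + 1))) =
      ∑ k, omega (v k) (u (k + 1) - u (k - 1)) := by
  have hshift : ∑ k, omega (u k) (v (k + 1)) = ∑ k, omega (u (k - 1)) (v k) :=
    Fintype.sum_equiv (Equiv.addRight 1) _ _ fun k => by simp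
  rw [Finset.sum_add_distrib, hshift, ← Finset.sum_add_distrib]
  refine Finset.sum_congr rfl fun k _ => ?_
  rw [omega_sub_right, omega_antisymm (u (k - 1))]
  ring

theorem eq_norm_div_norm_of_eq_smul {E : Type*} [NormedAddCommGroup E] [NormedSpace ℝ E]
    {v w : E} {α : ℝ} (hα : 0 ≤ α) (hw : w ≠ 0) (h : v = α • w) : α = ‖v‖ / ‖w‖ := by
  rw [h, norm_smul, Real.norm_of_nonneg hα, mul_div_cancel_right₀ _ (norm_ne_zero_iff.2 hw)]

/-- Derivative of the symplectic billiard action along a deformation (Lemma 3.1). -/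
theorem derivative_of_action (I : Set ℝ) (τ₀ : ℝ) (hI : I ∈ nhds τ₀) (hIconn : I.OrdConnected)
    (γ : ℝ → ℝ → EuclideanSpace ℝ (Fin 2))
    (hγ : ContDiff ℝ 1 (fun p : ℝ × ℝ => γ p.1 p.2))
    (q : ℕ) [NeZero q] (hq : 3 ≤ q) (t : ZMod q → ℝ)
    (htan : ∀ k : ZMod q, deriv (fun s => γ τ₀ s) (t k) ≠ 0)
    (hrefl : ∀ k : ZMod q, ∃ α : ℝ, 0 < α ∧
      γ τ₀ (t (k + 1)) - γ τ₀ (t (k - 1)) = α • deriv (fun s => γ τ₀ s) (t k)) :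
    (∀ k : ZMod q, ∀ α : ℝ, 0 < α →
        γ τ₀ (t (k + 1)) - γ τ₀ (t (k - 1)) = α • deriv (fun s => γ τ₀ s) (t k) →
        α = ‖γ τ₀ (t (k + 1)) - γ τ₀ (t (k - 1))‖ / ‖deriv (fun s => γ τ₀ s) (t k)‖) ∧
    HasDerivAt (fun τ => ∑ k : ZMod q, omega (γ τ (t k)) (γ τ (t (k + 1))))
      (∑ k : ZMod q,
        omega (deriv (fun τ => γ τ (t k)) τ₀) (deriv (fun s => γ τ₀ s) (t k)) *
          (‖γ τ₀ (t (k + 1)) - γ τ₀ (t (k - 1))‖ / ‖deriv (fun s => γ τ₀ s) (t k)‖)) τ₀ := by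
  have hratio (k : ZMod q) (α : ℝ) (hα : 0 < α)
      (h : γ τ₀ (t (k + 1)) - γ τ₀ (t (k - 1)) = α • deriv (fun s => γ τ₀ s) (t k)) :
      α = ‖γ τ₀ (t (k + 1)) - γ τ₀ (t (k - 1))‖ / ‖deriv (fun s => γ τ₀ s) (t k)‖ :=
    eq_norm_div_norm_of_eq_smul hα.le (htan k) h
  refine ⟨hratio, ?_⟩
  have hderiv (k : ZMod q) :
      HasDerivAt (fun τ => γ τ (t k)) (deriv (fun τ => γ τ (t k)) τ₀) τ₀ := by
    have hpath : Differentiable ℝ fun τ : ℝ => (τ, t k) := by fun_prop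
    exact ((hγ.differentiable one_ne_zero).comp hpath τ₀).hasDerivAt
  have hsum := HasDerivAt.fun_sum (u := Finset.univ)
    fun (k : ZMod q) _ => (hderiv k).omega_apply (hderiv (k + 1))
  rw [sum_omega_add_omega (fun k => γ τ₀ (t k)) fun k => deriv (fun τ => γ τ (t k)) τ₀] at hsum
  refine hsum.congr_deriv (Finset.sum_congr rfl fun k _ => ?_)
  obtain ⟨α, hα, h⟩ := hrefl k
  rw [← hratio k α hα h, h, omega_smul_right]
end

section
/- Let I ⊆ ℝ be an interval containing 0 and let γ : I × ℝ → ℝ² be a smooth (C^∞) map such that: for every τ ∈ I, s ↦ γ(τ,s) is 1-periodic, injective on [0,1), and ∂ₛγ(τ,s) ≠ 0 for all s. If ω(∂_τγ(τ,s), ∂ₛγ(τ,s)) = 0 for all (τ,s) ∈ I × ℝ, then for every τ ∈ I the image of the curve γ(τ,·) equals the image of γ(0,·) (the deformation is trivial). -/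
open Real

open Set Filter Topology

lemma inner_eq_zero_of_omega_eq_zero {u v w : EuclideanSpace ℝ (Fin 2)} (hw : w ≠ 0)
    (huw : inner ℝ u w = 0) (hvw : omega v w = 0) : inner ℝ u v = 0 := by
  have hw' : w 0 ^ 2 + w 1 ^ 2 ≠ 0 := by
    intro h
    apply hw
    ext i
    fin_cases i
    · simpa using (by nlinarith [sq_nonneg (w 0), sq_nonneg (w 1)] : w 0 ^ 2 = 0)
    · simpa using (by nlinarith [sq_nonneg (w 0), sq_nonneg (w 1)] : w 1 ^ 2 = 0)
  simp only [PiLp.inner_apply, Fin.sum_univ_two, RCLike.inner_apply, conj_trivial, omega] at *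
  refine (mul_eq_zero.mp ?_).resolve_right hw'
  linear_combination (v 0 * w 0 + v 1 * w 1) * huw + (u 0 * w 1 - u 1 * w 0) * hvw

/-- The squared distance from `p` to the arc `c '' [0, 1]`. -/
noncomputable def sqDistArc (c : ℝ → EuclideanSpace ℝ (Fin 2)) (p : EuclideanSpace ℝ (Fin 2)) :
    ℝ :=
  sInf ((fun s => ‖c s - p‖ ^ 2) '' Icc 0 1)

lemma sqDistArc_le (c : ℝ → EuclideanSpace ℝ (Fin 2)) (p : EuclideanSpace ℝ (Fin 2)) {s : ℝ}
    (hs : s ∈ Icc (0 : ℝ) 1) : sqDistArc c p ≤ ‖c s - p‖ ^ 2 := by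
  refine csInf_le ⟨0, ?_⟩ ⟨s, hs, rfl⟩
  rintro _ ⟨x, -, rfl⟩
  positivity

lemma exists_sqDistArc_eq {c : ℝ → EuclideanSpace ℝ (Fin 2)} (hc : Continuous c)
    (p : EuclideanSpace ℝ (Fin 2)) :
    ∃ s ∈ Icc (0 : ℝ) 1, sqDistArc c p = ‖c s - p‖ ^ 2 := by
  have hf : Continuous fun s => ‖c s - p‖ ^ 2 := by fun_prop
  exact isCompact_Icc.exists_sInf_image_eq (nonempty_Icc.mpr zero_le_one) hf.continuousOn

lemma sqDistArc_le_of_periodic {c : ℝ → EuclideanSpace ℝ (Fin 2)}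
    (hc : Function.Periodic c 1) (p : EuclideanSpace ℝ (Fin 2)) (s : ℝ) :
    sqDistArc c p ≤ ‖c s - p‖ ^ 2 := by
  obtain ⟨y, hy, hxy⟩ := hc.exists_mem_Ico₀ one_pos s
  rw [hxy]
  exact sqDistArc_le c p (Ico_subset_Icc_self hy)

/-- Along a deformation with vanishing normal displacement, the squared distance to a fixed
point does not increase. -/
lemma sqDistArc_le_sqDistArc {I : Set ℝ} (hI : I.OrdConnected)
    {γ : ℝ → ℝ → EuclideanSpace ℝ (Fin 2)}
    (hγ : ContDiff ℝ 1 (fun p : ℝ × ℝ => γ p.1 p.2))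
    (hper : ∀ τ ∈ I, Function.Periodic (γ τ) 1)
    (hreg : ∀ τ ∈ I, ∀ s : ℝ, deriv (γ τ) s ≠ 0)
    (hn : ∀ τ ∈ I, ∀ s : ℝ, omega (deriv (fun τ' => γ τ' s) τ) (deriv (γ τ) s) = 0)
    {a b : ℝ} (ha : a ∈ I) (hb : b ∈ I) (p : EuclideanSpace ℝ (Fin 2)) :
    sqDistArc (γ b) p ≤ sqDistArc (γ a) p := by
  have hd := hγ.differentiable one_ne_zero
  have hd₁ (s : ℝ) : Differentiable ℝ fun τ => γ τ s :=
    hd.comp (differentiable_id.prodMk (differentiable_const s))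
  have hd₂ (τ : ℝ) : Differentiable ℝ (γ τ) :=
    hd.comp ((differentiable_const τ).prodMk differentiable_id)
  have hm : Continuous fun τ => sqDistArc (γ τ) p := by
    refine isCompact_Icc.continuous_sInf (f := fun τ s => ‖γ τ s - p‖ ^ 2) ?_
    exact (hγ.continuous.sub continuous_const).norm.pow 2
  let e : ℝ → ℝ := fun t => a + t * (b - a)
  have he : ∀ t, HasDerivAt e (b - a) t := fun t => by
    simpa [e] using ((hasDerivAt_id t).mul_const (b - a)).const_add a
  have heI : ∀ t ∈ Icc (0 : ℝ) 1, e t ∈ I := fun t ht =>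
    hI.convex.add_smul_sub_mem ha hb ht
  have he0 : e 0 = a := by simp [e]
  have he1 : e 1 = b := by simp [e]
  have key := image_le_of_liminf_slope_right_le_deriv_boundary
    (f := fun t => sqDistArc (γ (e t)) p) (a := 0) (b := 1)
    (B := fun _ => sqDistArc (γ a) p) (B' := fun _ => 0)
    (hm.comp (by fun_prop)).continuousOn (by simp [he0]) continuousOn_const
    (fun x _ => hasDerivWithinAt_const _ _ _) (fun t ht r hr => ?_)
    (right_mem_Icc.mpr zero_le_one)
  · simpa [he1] using key
  have htI := heI t (Ico_subset_Icc_self ht)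
  obtain ⟨s, hs, hsm⟩ := exists_sqDistArc_eq (hd₂ (e t)).continuous p
  have hmin : IsLocalMin (fun s => ‖γ (e t) s - p‖ ^ 2) s :=
    Eventually.of_forall fun x => hsm.symm.trans_le <| sqDistArc_le_of_periodic (hper _ htI) p x
  have hcrit := hmin.hasDerivAt_eq_zero ((hd₂ (e t) s).hasDerivAt.sub_const p).norm_sq
  have horth := inner_eq_zero_of_omega_eq_zero (hreg _ htI s)
    ((mul_eq_zero.mp hcrit).resolve_left two_ne_zero) (hn _ htI s)
  have hH : HasDerivAt (fun z => ‖γ (e z) s - p‖ ^ 2) 0 t := by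
    have h := ((hd₁ s (e t)).hasDerivAt.sub_const p).norm_sq.comp t (he t)
    rw [horth] at h
    simpa [Function.comp_def] using h
  have hlim := (hasDerivWithinAt_iff_tendsto_slope' self_notMem_Ioi).mp
    (hH.hasDerivWithinAt (s := Ioi t))
  refine Eventually.frequently ?_
  filter_upwards [hlim.eventually_lt_const hr, self_mem_nhdsWithin] with z hz hzt
  refine lt_of_le_of_lt ?_ hz
  rw [slope_def_field, slope_def_field]
  have : 0 < z - t := sub_pos.mpr hzt
  have := sqDistArc_le (γ (e z)) p hs
  rw [hsm]
  gcongr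

lemma range_subset_range_of_omega_eq_zero {I : Set ℝ} (hI : I.OrdConnected)
    {γ : ℝ → ℝ → EuclideanSpace ℝ (Fin 2)}
    (hγ : ContDiff ℝ 1 (fun p : ℝ × ℝ => γ p.1 p.2))
    (hper : ∀ τ ∈ I, Function.Periodic (γ τ) 1)
    (hreg : ∀ τ ∈ I, ∀ s : ℝ, deriv (γ τ) s ≠ 0)
    (hn : ∀ τ ∈ I, ∀ s : ℝ, omega (deriv (fun τ' => γ τ' s) τ) (deriv (γ τ) s) = 0)
    {a b : ℝ} (ha : a ∈ I) (hb : b ∈ I) : range (γ a) ⊆ range (γ b) := by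
  rintro _ ⟨x, rfl⟩
  have hc : Continuous (γ b) :=
    hγ.continuous.comp (continuous_const.prodMk continuous_id)
  obtain ⟨s, -, hs⟩ := exists_sqDistArc_eq hc (γ a x)
  have h₁ := sqDistArc_le_sqDistArc hI hγ hper hreg hn ha hb (γ a x)
  have h₂ := sqDistArc_le_of_periodic (hper a ha) (γ a x) x
  simp only [sub_self, norm_zero] at h₂
  have h₃ : ‖γ b s - γ a x‖ ^ 2 = 0 := le_antisymm (by linarith) (by positivity)
  exact ⟨s, by simpa [sub_eq_zero] using h₃⟩

/-- If the deformation function `n_τ(s) = ω(∂_τ γ, ∂_s γ)` of a smooth family of closed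
embedded regular curves vanishes identically, the deformation is trivial (Proposition 3.2). -/
theorem vanishing_deformation_map_implies_trivial
    (I : Set ℝ) (hIconn : I.OrdConnected) (h0 : (0 : ℝ) ∈ I)
    (γ : ℝ → ℝ → EuclideanSpace ℝ (Fin 2))
    (hγ : ContDiff ℝ (⊤ : ℕ∞) (fun p : ℝ × ℝ => γ p.1 p.2))
    (hper : ∀ τ ∈ I, ∀ s : ℝ, γ τ (s + 1) = γ τ s)
    (hinj : ∀ τ ∈ I, Set.InjOn (γ τ) (Set.Ico 0 1))
    (hreg : ∀ τ ∈ I, ∀ s : ℝ, deriv (γ τ) s ≠ 0)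
    (hn : ∀ τ ∈ I, ∀ s : ℝ, omega (deriv (fun τ' => γ τ' s) τ) (deriv (γ τ) s) = 0) :
    ∀ τ ∈ I, Set.range (γ τ) = Set.range (γ 0) := by
  have hγ' : ContDiff ℝ 1 (fun p : ℝ × ℝ => γ p.1 p.2) := hγ.of_le (by exact_mod_cast le_top)
  intro τ hτ
  exact Subset.antisymm
    (range_subset_range_of_omega_eq_zero hIconn hγ' hper hreg hn hτ h0)
    (range_subset_range_of_omega_eq_zero hIconn hγ' hper hreg hn h0 hτ)
end

section
/- Let ℓ > 0 and let δ : ℝ → ℝ² be a C³, ℓ-periodic curve parametrized by Euclidean arclength (‖δ'(s)‖ = 1 for all s) whose curvature κ(s) = ω(δ'(s), δ''(s)) is strictly positive for all s. Set L = ∫₀^ℓ κ(s)^{1/3} ds. Then there exists a C² strictly increasing bijection φ : ℝ → ℝ with φ(t + L) = φ(t) + ℓ for all t, such that the reparametrized curve γ = δ ∘ φ is C², L-periodic, and satisfies ω(γ'(t), γ''(t)) = 1 for every t ∈ ℝ (i.e. γ is an affine arclength parametrization). -/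
open Real

/-- A periodic positive `C¹` function is the reciprocal speed of a `C²` increasing bijection of the
line. -/
theorem exists_contDiff_two_reparametrization {f : ℝ → ℝ} (hf : ContDiff ℝ 1 f)
    (hpos : ∀ s, 0 < f s) {T : ℝ} (hT : 0 < T) (hper : Function.Periodic f T) :
    ∃ φ : ℝ → ℝ, ContDiff ℝ 2 φ ∧ StrictMono φ ∧ Function.Bijective φ ∧
      (∀ t, φ (t + ∫ s in (0 : ℝ)..T, f s) = φ t + T) ∧ ∀ t, HasDerivAt φ (f (φ t))⁻¹ t := by
  have hcont : Continuous f := hf.continuous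
  have hfint : ∀ a b, IntervalIntegrable f MeasureTheory.volume a b :=
    fun a b => hcont.intervalIntegrable a b
  let F : ℝ → ℝ := fun s => ∫ x in (0 : ℝ)..s, f x
  have hF : ∀ s, HasDerivAt F (f s) s := fun s => hcont.integral_hasStrictDerivAt 0 s |>.hasDerivAt
  have hFcont : Continuous F := continuous_iff_continuousAt.2 fun s => (hF s).continuousAt
  have hmono : StrictMono F := strictMono_of_hasDerivAt_pos hF hpos
  have hFsurj : Function.Surjective F := hFcont.surjective
    (hper.tendsto_atTop_intervalIntegral_of_pos' (hfint 0 T) hpos hT)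
    (hper.tendsto_atBot_intervalIntegral_of_pos' (hfint 0 T) hpos hT)
  have hFper : ∀ s, F (s + T) = F s + F T := fun s => by
    simpa [F] using hper.intervalIntegral_add_eq_add 0 s hfint
  let e := hmono.orderIsoOfSurjective F hFsurj
  have he : ∀ s, e s = F s := fun s => rfl
  have hd : ∀ t, HasDerivAt e.symm (f (e.symm t))⁻¹ t := fun t =>
    HasDerivAt.of_local_left_inverse e.symm.continuous.continuousAt (hF _) (hpos _).ne'
      (Filter.Eventually.of_forall fun y => e.apply_symm_apply y)
  have hderiv : deriv e.symm = fun t => (f (e.symm t))⁻¹ := funext fun t => (hd t).deriv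
  have hdiff : Differentiable ℝ e.symm := fun t => (hd t).differentiableAt
  have hC1 : ContDiff ℝ 1 e.symm := by
    rw [contDiff_one_iff_deriv, hderiv]
    exact ⟨hdiff, (hcont.comp e.symm.continuous).inv₀ fun t => (hpos _).ne'⟩
  refine ⟨e.symm, ?_, e.symm.strictMono, e.symm.bijective, fun t => ?_, hd⟩
  · rw [show (2 : WithTop ℕ∞) = 1 + 1 from one_add_one_eq_two.symm, contDiff_succ_iff_deriv, hderiv]
    exact ⟨hdiff, by simp, (hf.comp hC1).inv fun t => (hpos _).ne'⟩
  · rw [e.symm_apply_eq, he, hFper, ← he, e.apply_symm_apply]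

/-- Existence of the affine arclength parametrization of a closed strictly convex curve
(Proposition A.1). -/
theorem exists_affine_arclength_parametrization (ℓ : ℝ) (hℓ : 0 < ℓ)
    (δ : ℝ → EuclideanSpace ℝ (Fin 2)) (hδ : ContDiff ℝ 3 δ)
    (hper : ∀ s, δ (s + ℓ) = δ s)
    (hunit : ∀ s, ‖deriv δ s‖ = 1)
    (hκ : ∀ s, 0 < omega (deriv δ s) (deriv (deriv δ) s))
    (L : ℝ)
    (hL : L = ∫ s in (0 : ℝ)..ℓ, (omega (deriv δ s) (deriv (deriv δ) s)) ^ ((1 : ℝ) / 3)) :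
    ∃ φ : ℝ → ℝ, ContDiff ℝ 2 φ ∧ StrictMono φ ∧ Function.Bijective φ ∧
      (∀ t, φ (t + L) = φ t + ℓ) ∧ ContDiff ℝ 2 (δ ∘ φ) ∧
      (∀ t, (δ ∘ φ) (t + L) = (δ ∘ φ) t) ∧
      ∀ t, omega (deriv (δ ∘ φ) t) (deriv (deriv (δ ∘ φ)) t) = 1 := by
  have hδ' : ContDiff ℝ 2 (deriv δ) := ContDiff.iterate_deriv' 2 1 hδ
  have hδ'' : ContDiff ℝ 1 (deriv (deriv δ)) := ContDiff.iterate_deriv' 1 2 hδ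
  have hderiv_per : ∀ {g : ℝ → EuclideanSpace ℝ (Fin 2)}, Function.Periodic g ℓ →
      Function.Periodic (deriv g) ℓ := fun {g} hg s => by
    rw [← deriv_comp_add_const, funext hg]
  have hp' : Function.Periodic (deriv δ) ℓ := hderiv_per hper
  have hp'' : Function.Periodic (deriv (deriv δ)) ℓ := hderiv_per hp'
  have hcoord : ∀ {g : ℝ → EuclideanSpace ℝ (Fin 2)}, ContDiff ℝ 1 g →
      ∀ i, ContDiff ℝ 1 fun s => g s i := fun hg i => contDiff_euclidean.1 hg i
  have hκC : ContDiff ℝ 1 fun s => omega (deriv δ s) (deriv (deriv δ) s) := by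
    have hg : ContDiff ℝ 1 (deriv δ) := hδ'.of_le (by norm_num)
    exact ((hcoord hg 0).mul (hcoord hδ'' 1)).sub ((hcoord hg 1).mul (hcoord hδ'' 0))
  obtain ⟨φ, hφ, hmono, hbij, hshift, hder⟩ := exists_contDiff_two_reparametrization
    (f := fun s => omega (deriv δ s) (deriv (deriv δ) s) ^ ((1 : ℝ) / 3))
    (hκC.rpow_const_of_ne fun s => (hκ s).ne') (fun s => rpow_pos_of_pos (hκ s) _) hℓ
    (fun s => by simp only [hp' s, hp'' s])
  rw [← hL] at hshift
  refine ⟨φ, hφ, hmono, hbij, hshift, (hδ.of_le (by norm_num)).comp hφ, fun t => ?_, fun t => ?_⟩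
  · simp only [Function.comp_apply, hshift, hper]
  have hφd : ∀ t, HasDerivAt φ (deriv φ t) t := fun t => (hder t).differentiableAt.hasDerivAt
  have hφ'd : DifferentiableAt ℝ (deriv φ) t :=
    (ContDiff.iterate_deriv' 1 1 hφ).differentiable (by norm_num) t
  have h1 : deriv (δ ∘ φ) = fun t => deriv φ t • deriv δ (φ t) := funext fun t =>
    ((hδ.differentiable (by norm_num) _).hasDerivAt.scomp t (hφd t)).deriv
  have h2 : deriv (deriv (δ ∘ φ)) t = deriv φ t • deriv φ t • deriv (deriv δ) (φ t) +
      deriv (deriv φ) t • deriv δ (φ t) := by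
    rw [h1]
    exact (hφ'd.hasDerivAt.smul
      ((hδ'.differentiable (by norm_num) _).hasDerivAt.scomp t (hφd t))).deriv
  have h3 : deriv φ t ^ 3 * omega (deriv δ (φ t)) (deriv (deriv δ) (φ t)) = 1 := by
    have hk := hκ (φ t)
    rw [(hder t).deriv, inv_pow, ← rpow_natCast, ← rpow_mul hk.le]
    norm_num
    exact inv_mul_cancel₀ hk.ne'
  rw [h2, h1, ← h3]
  simp only [omega, PiLp.add_apply, PiLp.smul_apply, smul_eq_mul]
  ring
end

section
/- Let γ : ℝ → ℝ² be a C³ curve with ω(γ'(t), γ''(t)) = 1 for all t. Define the radius of curvature ϱ(t) = ‖γ'(t)‖³ and the affine curvature k(t) = ω(γ''(t), γ'''(t)). Then at every t where ϱ is twice differentiable (which holds for all t since γ is C³ and γ' never vanishes), k(t) = ϱ(t)^{−4/3} − (1/3)·ϱ''(t)·ϱ(t)^{−1} + (2/9)·ϱ'(t)²·ϱ(t)^{−2}. -/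
open Real

theorem hasDerivAt_euclideanSpace_apply {ι : Type*} [Fintype ι] {f : ℝ → EuclideanSpace ℝ ι}
    {f' : EuclideanSpace ℝ ι} {t : ℝ} (h : HasDerivAt f f' t) (i : ι) :
    HasDerivAt (fun s => f s i) (f' i) t :=
  (EuclideanSpace.proj i : EuclideanSpace ℝ ι →L[ℝ] ℝ).hasFDerivAt.comp_hasDerivAt t h

theorem hasDerivAt_omega {u v : ℝ → EuclideanSpace ℝ (Fin 2)} {u' v' : EuclideanSpace ℝ (Fin 2)}
    {t : ℝ} (hu : HasDerivAt u u' t) (hv : HasDerivAt v v' t) :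
    HasDerivAt (fun s => omega (u s) (v s))
      (omega u' (v t) + omega (u t) v') t := by
  have hc := hasDerivAt_euclideanSpace_apply hu
  have hd := hasDerivAt_euclideanSpace_apply hv
  refine (((hc 0).mul (hd 1)).sub ((hc 1).mul (hd 0))).congr_deriv ?_
  unfold omega
  ring

theorem hasDerivAt_norm {E : Type*} [NormedAddCommGroup E] [InnerProductSpace ℝ E]
    {f : ℝ → E} {f' : E} {t : ℝ} (h : HasDerivAt f f' t) (h0 : f t ≠ 0) :
    HasDerivAt (fun s => ‖f s‖) (inner ℝ (f t) f' / ‖f t‖) t := by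
  have hn : ‖f t‖ ≠ 0 := norm_ne_zero_iff.mpr h0
  have := h.norm_sq.sqrt (pow_ne_zero 2 hn)
  simp only [Real.sqrt_sq (norm_nonneg _)] at this
  convert this using 1
  field_simp

/-- The pointwise identity behind the curvature formula: `v`, `w`, `z` play the roles of the
first three derivatives of an affine arclength parametrization. -/
theorem omega_eq_of_omega_eq_one {v w z : EuclideanSpace ℝ (Fin 2)} (h1 : omega v w = 1)
    (h0 : omega v z = 0) :
    omega w z * ‖v‖ ^ 4 =
      1 + inner ℝ v w ^ 2 - (inner ℝ w w + inner ℝ v z) * ‖v‖ ^ 2 := by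
  have hr : ‖v‖ ^ 4 = (‖v‖ ^ 2) ^ 2 := by ring
  rw [hr, EuclideanSpace.real_norm_sq_eq]
  simp only [omega, PiLp.inner_apply, Fin.sum_univ_two, RCLike.inner_apply, conj_trivial] at *
  have ha : z 0 = -(w 0 * z 1 - w 1 * z 0) * v 0 := by linear_combination (-z 0) * h1 + w 0 * h0
  have hb : z 1 = -(w 0 * z 1 - w 1 * z 0) * v 1 := by linear_combination (-z 1) * h1 + w 1 * h0
  linear_combination (v 0 * ha + v 1 * hb) * (v 0 ^ 2 + v 1 ^ 2) +
    (v 0 * w 1 - v 1 * w 0 + 1) * h1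

/-- Formula for the affine curvature in terms of the Euclidean radius of curvature
`ϱ = ‖γ'‖³` and its derivatives with respect to the affine parameter (Proposition A.2). -/
theorem affine_curvature_formula (γ : ℝ → EuclideanSpace ℝ (Fin 2)) (hγ : ContDiff ℝ 3 γ)
    (haff : ∀ t, omega (deriv γ t) (deriv (deriv γ) t) = 1)
    (ϱ k : ℝ → ℝ)
    (hϱ : ∀ t, ϱ t = ‖deriv γ t‖ ^ 3)
    (hk : ∀ t, k t = omega (deriv (deriv γ) t) (deriv (deriv (deriv γ)) t)) :
    ∀ t, k t = ϱ t ^ (-(4 : ℝ) / 3) - (1 / 3) * deriv (deriv ϱ) t * (ϱ t)⁻¹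
      + (2 / 9) * (deriv ϱ t) ^ 2 * ((ϱ t) ^ 2)⁻¹ := by
  have hd1 : ContDiff ℝ 2 (deriv γ) := ((contDiff_succ_iff_deriv (n := 2)).1 hγ).2.2
  have hd2 : ContDiff ℝ 1 (deriv (deriv γ)) := ((contDiff_succ_iff_deriv (n := 1)).1 hd1).2.2
  have hv t : HasDerivAt (deriv γ) (deriv (deriv γ) t) t :=
    (hd1.differentiable (by norm_num) t).hasDerivAt
  have hw t : HasDerivAt (deriv (deriv γ)) (deriv (deriv (deriv γ)) t) t :=
    (hd2.differentiable (by norm_num) t).hasDerivAt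
  have hne t : deriv γ t ≠ 0 := by
    intro h
    have := haff t
    simp [h, omega] at this
  have hpos t : 0 < ‖deriv γ t‖ := norm_pos_iff.mpr (hne t)
  have hnorm t := hasDerivAt_norm (hv t) (hne t)
  have hderiv : deriv ϱ =
      fun t => 3 * (‖deriv γ t‖ * inner ℝ (deriv γ t) (deriv (deriv γ) t)) := by
    funext t
    rw [funext hϱ, ((hnorm t).fun_pow 3).deriv]
    have := (hpos t).ne'
    field_simp
    norm_num
    ring
  intro t
  have hderiv2 := (((hnorm t).fun_mul ((hv t).inner ℝ (hw t))).const_mul 3).deriv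
  have h0 : omega (deriv γ t) (deriv (deriv (deriv γ)) t) = 0 := by
    have h := hasDerivAt_omega (hv t) (hw t)
    simp only [haff] at h
    have := h.unique (hasDerivAt_const t (1 : ℝ))
    simp only [omega] at this ⊢
    linarith
  have key := omega_eq_of_omega_eq_one (haff t) h0
  have hrpow : (‖deriv γ t‖ ^ 3) ^ (-(4 : ℝ) / 3) = (‖deriv γ t‖ ^ 4)⁻¹ := by
    rw [← Real.rpow_natCast, ← Real.rpow_mul (hpos t).le, ← Real.rpow_natCast,
      ← Real.rpow_neg (hpos t).le]
    norm_num
  rw [hderiv, hderiv2, hϱ, hrpow, hk]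
  have hr := (hpos t).ne'
  rw [← mul_left_inj' (pow_ne_zero 4 hr), key]
  field_simp
  ring
end

section
/- Let k > 0 be a real constant and let γ : ℝ → ℝ² be a C³ curve satisfying the differential equation γ'''(t) = −k·γ'(t) for all t ∈ ℝ. Then there exist vectors u, v, w ∈ ℝ² such that γ(t) = cos(√k·t)·u + sin(√k·t)·v + w for all t ∈ ℝ. In particular, a closed strictly convex curve with constant positive affine curvature is an ellipse. -/
open Real

/-- Solutions of `γ''' = -s² γ'` in a real normed space are trigonometric polynomials. -/
theorem exists_eq_cos_smul_add_sin_smul_add {E : Type*} [NormedAddCommGroup E] [NormedSpace ℝ E]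
    {s : ℝ} (hs : s ≠ 0) {γ g h : ℝ → E} (hγ : ∀ t, HasDerivAt γ (g t) t)
    (hg : ∀ t, HasDerivAt g (h t) t) (hh : ∀ t, HasDerivAt h (-(s ^ 2) • g t) t) :
    ∃ u v w : E, ∀ t : ℝ, γ t = cos (s * t) • u + sin (s * t) • v + w := by
  have hconst : ∀ f : ℝ → E, (∀ t, HasDerivAt f 0 t) → ∀ t, f t = f 0 := fun f hf t =>
    is_const_of_deriv_eq_zero (fun x => (hf x).differentiableAt) (fun x => (hf x).deriv) t 0
  have hst (t : ℝ) : HasDerivAt (fun x => s * x) s t := by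
    simpa using (hasDerivAt_id t).const_mul s
  have hcos (t : ℝ) := (hst t).cos
  have hsin (t : ℝ) := (hst t).sin
  let u : ℝ → E := fun t => -(s ^ 2)⁻¹ • cos (s * t) • h t - s⁻¹ • sin (s * t) • g t
  let v : ℝ → E := fun t => -(s ^ 2)⁻¹ • sin (s * t) • h t + s⁻¹ • cos (s * t) • g t
  let w : ℝ → E := fun t => γ t + (s ^ 2)⁻¹ • h t
  have hu : ∀ t, u t = u 0 := by
    refine hconst u fun t => ?_
    refine ((((hcos t).smul (hh t)).const_smul (-(s ^ 2)⁻¹)).sub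
      (((hsin t).smul (hg t)).const_smul s⁻¹)).congr_deriv ?_
    match_scalars <;> field
  have hv : ∀ t, v t = v 0 := by
    refine hconst v fun t => ?_
    refine ((((hsin t).smul (hh t)).const_smul (-(s ^ 2)⁻¹)).add
      (((hcos t).smul (hg t)).const_smul s⁻¹)).congr_deriv ?_
    match_scalars <;> field
  have hw : ∀ t, w t = w 0 := by
    refine hconst w fun t => ?_
    refine ((hγ t).add ((hh t).const_smul (s ^ 2)⁻¹)).congr_deriv ?_
    match_scalars
    field
  refine ⟨u 0, v 0, w 0, fun t => ?_⟩
  rw [← hu t, ← hv t, ← hw t]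
  simp only [u, v, w]
  match_scalars
  · ring
  · field_simp
    linear_combination sin_sq_add_cos_sq (s * t)
  · ring

/-- A curve with `γ''' = -k γ'` for a positive constant `k` is (part of) an ellipse
(Proposition A.3). -/
theorem constant_affine_curvature_is_ellipse (k : ℝ) (hk : 0 < k)
    (γ : ℝ → EuclideanSpace ℝ (Fin 2)) (hγ : ContDiff ℝ 3 γ)
    (hode : ∀ t, deriv (deriv (deriv γ)) t = -k • deriv γ t) :
    ∃ u v w : EuclideanSpace ℝ (Fin 2), ∀ t : ℝ,
      γ t = Real.cos (Real.sqrt k * t) • u + Real.sin (Real.sqrt k * t) • v + w := by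
  have h₁ : ContDiff ℝ 2 (deriv γ) :=
    ContDiff.deriv' (n := 2) (by simpa [two_add_one_eq_three] using hγ)
  have h₂ : ContDiff ℝ 1 (deriv (deriv γ)) :=
    ContDiff.deriv' (n := 1) (by simpa [one_add_one_eq_two] using h₁)
  refine exists_eq_cos_smul_add_sin_smul_add (sqrt_pos.2 hk).ne'
    (fun t => (hγ.differentiable (by norm_num) t).hasDerivAt)
    (fun t => (h₁.differentiable (by norm_num) t).hasDerivAt) fun t => ?_
  rw [sq_sqrt hk.le, ← hode t]
  exact (h₂.differentiable (by norm_num) t).hasDerivAt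
end

section
/- Let γ : ℝ → ℝ² be a C⁷, 1-periodic curve with ω(γ'(t), γ''(t)) = 1 for all t, and let k be its affine curvature (the C⁴ function with γ''' = −k·γ'). Fix t₁ ∈ ℝ. Then there exist δ > 0, C > 0, and a C⁶ function φ : (−δ, δ) → ℝ with φ(0) = 0, such that for every ε ∈ (0, δ): ω(γ(t₁ + φ(ε)) − γ(t₁ − ε), γ'(t₁)) = 0 (so the symplectic billiard map sends the chord from γ(t₁−ε) to γ(t₁) to the chord from γ(t₁) to γ(t₁+φ(ε))), and |φ(ε) − ε − (1/30)·k'(t₁)·ε⁴| ≤ C·ε⁶. In other words, in the coordinates (t, ε) with t₁ = t + ε, the symplectic billiard map has the expansion ε₁ = ε + (1/30)k'(t)ε⁴ + O(ε⁶). -/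
open Real

open Filter Topology Asymptotics MeasureTheory

/-- The weighted mean `∫₀¹ uʲ F(su) du` of `F` over the segment from `0` to `s`. -/
noncomputable def segmentMean (j : ℕ) (F : ℝ → ℝ) (s : ℝ) : ℝ :=
  ∫ u in (0 : ℝ)..1, u ^ j * F (s * u)

lemma hasDerivAt_segmentMean (j : ℕ) {F : ℝ → ℝ} (hF : ContDiff ℝ 1 F) (s : ℝ) :
    HasDerivAt (segmentMean j F) (segmentMean (j + 1) (deriv F) s) s := by
  have hF' : Continuous (deriv F) := hF.continuous_deriv le_rfl
  have hFc : Continuous F := hF.continuous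
  have hcpt : IsCompact (Set.Icc (s - 1) (s + 1) ×ˢ Set.Icc (0 : ℝ) 1) :=
    isCompact_Icc.prod isCompact_Icc
  obtain ⟨M, hM⟩ := hcpt.exists_bound_of_continuousOn
    (f := fun z : ℝ × ℝ => z.2 ^ (j + 1) * deriv F (z.1 * z.2)) (by fun_prop)
  refine (intervalIntegral.hasDerivAt_integral_of_dominated_loc_of_deriv_le
    (F := fun x u => u ^ j * F (x * u)) (F' := fun x u => u ^ (j + 1) * deriv F (x * u))
    (bound := fun _ => M) (Icc_mem_nhds (sub_one_lt s) (lt_add_one s))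
    (Eventually.of_forall fun x => ?_) ?_ ?_ (ae_of_all _ fun u hu x hx => ?_) ?_
    (ae_of_all _ fun u _ x _ => ?_)).2
  · exact Continuous.aestronglyMeasurable (by fun_prop)
  · exact Continuous.intervalIntegrable (by fun_prop) _ _
  · exact Continuous.aestronglyMeasurable (by fun_prop)
  · rw [Set.uIoc_of_le zero_le_one] at hu
    exact hM (x, u) ⟨hx, hu.1.le, hu.2⟩
  · exact intervalIntegrable_const
  · have h : HasDerivAt (fun x : ℝ => x * u) u x := by simpa using (hasDerivAt_id x).mul_const u
    have hd := (hF.differentiable one_ne_zero (x * u)).hasDerivAt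
    convert! (hd.comp x h).const_mul (u ^ j) using 1
    ring

lemma contDiff_segmentMean {n : ℕ} {j : ℕ} {F : ℝ → ℝ} (hF : ContDiff ℝ n F) :
    ContDiff ℝ n (segmentMean j F) := by
  induction n generalizing j F with
  | zero =>
    have hFc : Continuous F := hF.continuous
    simp only [Nat.cast_zero, contDiff_zero]
    exact intervalIntegral.continuous_parametric_intervalIntegral_of_continuous' (by fun_prop) _ _
  | succ n ih =>
    have h1 : ContDiff ℝ 1 F := hF.of_le (by exact_mod_cast Nat.le_add_left 1 n)
    push_cast at hF ⊢
    rw [contDiff_succ_iff_deriv] at hF ⊢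
    refine ⟨fun s => (hasDerivAt_segmentMean j h1 s).differentiableAt, by simp, ?_⟩
    rw [show deriv (segmentMean j F) = segmentMean (j + 1) (deriv F) from
      funext fun s => (hasDerivAt_segmentMean j h1 s).deriv]
    exact ih hF.2.2

lemma sub_eq_mul_segmentMean {F F' : ℝ → ℝ} (hF : ∀ s, HasDerivAt F (F' s) s)
    (hF' : Continuous F') (s : ℝ) : F s - F 0 = s * segmentMean 0 F' s := by
  have h : ∀ u ∈ Set.uIcc (0 : ℝ) 1, HasDerivAt (fun u => F (s * u)) (F' (s * u) * s) u :=
    fun u _ => (hF (s * u)).comp u (by simpa using (hasDerivAt_id u).const_mul s)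
  have hint := intervalIntegral.integral_eq_sub_of_hasDerivAt h
    (Continuous.intervalIntegrable (by fun_prop) _ _)
  simp only [intervalIntegral.integral_mul_const, mul_one, mul_zero] at hint
  simp only [segmentMean, pow_zero, one_mul]
  linarith

lemma exists_sqrt_chart {f f₁ f₂ : ℝ → ℝ} (hf : ∀ s, HasDerivAt f (f₁ s) s)
    (hf₁ : ∀ s, HasDerivAt f₁ (f₂ s) s) (hf₂ : ContDiff ℝ 5 f₂)
    (f_zero : f 0 = 0) (f₁_zero : f₁ 0 = 0) (f₂_zero : f₂ 0 = 1) :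
    ∃ g : ℝ → ℝ, ContDiffAt ℝ 6 g 0 ∧ g 0 = 0 ∧ HasDerivAt g 1 0 ∧
      ∀ᶠ s in 𝓝 0, g s ^ 2 = 2 * f s := by
  set p := segmentMean 0 f₂ with hp
  set q := segmentMean 1 p with hq
  have p_smooth : ContDiff ℝ 5 p := contDiff_segmentMean (n := 5) hf₂
  have q_smooth : ContDiff ℝ 5 q := contDiff_segmentMean (n := 5) p_smooth
  have f₁_eq (s : ℝ) : f₁ s = s * p s := by
    simpa [f₁_zero] using sub_eq_mul_segmentMean hf₁ hf₂.continuous s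
  have f_eq (s : ℝ) : f s = s ^ 2 * q s := by
    have h := sub_eq_mul_segmentMean hf
      (continuous_iff_continuousAt.2 fun s => (hf₁ s).continuousAt) s
    have h2 : segmentMean 0 f₁ s = s * q s := by
      simp only [hq, segmentMean, ← intervalIntegral.integral_const_mul, f₁_eq]
      congr 1 with u
      ring
    rw [f_zero, h2] at h
    linarith
  have p_zero : p 0 = 1 := by simp [hp, segmentMean, f₂_zero]
  have q_zero : q 0 = 1 / 2 := by
    simp [hq, segmentMean, p_zero]
  have hqd (s : ℝ) : HasDerivAt q (deriv q s) s :=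
    (q_smooth.differentiable (by norm_num) s).hasDerivAt
  have hpq (s : ℝ) : 2 * q s + s * deriv q s = p s := by
    rcases eq_or_ne s 0 with rfl | hs
    · rw [p_zero, q_zero]; norm_num
    · have h := ((hasDerivAt_pow 2 s).mul (hqd s)).unique
        ((hf s).congr_of_eventuallyEq (Eventually.of_forall fun x => (f_eq x).symm))
      rw [f₁_eq] at h
      refine mul_left_cancel₀ hs ?_
      rw [← h]
      push_cast
      ring
  have hU : IsOpen {s | 0 < q s} := isOpen_lt continuous_const q_smooth.continuous
  have hU0 : {s | 0 < q s} ∈ 𝓝 (0 : ℝ) := hU.mem_nhds (by simp [q_zero])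
  have hg (s : ℝ) (hs : 0 < q s) :
      HasDerivAt (fun s => s * √(2 * q s)) (p s / √(2 * q s)) s := by
    have h2 : 0 < 2 * q s := by linarith
    convert! (hasDerivAt_id s).mul (((hqd s).const_mul 2).sqrt h2.ne') using 1
    have := Real.sq_sqrt h2.le
    have := Real.sqrt_pos.2 h2
    simp only [id]
    field_simp
    rw [← hpq s]
    linarith
  refine ⟨fun s => s * √(2 * q s), ?_, by simp, ?_, ?_⟩
  · refine ContDiffOn.contDiffAt (s := {s | 0 < q s}) ?_ hU0
    rw [show (6 : WithTop ℕ∞) = 5 + 1 by norm_num, contDiffOn_succ_iff_deriv_of_isOpen hU]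
    refine ⟨fun s hs => (hg s hs).differentiableAt.differentiableWithinAt, by simp, ?_⟩
    refine ContDiffOn.congr (f := fun s => p s / √(2 * q s)) ?_ fun s hs => (hg s hs).deriv
    have hpos : ∀ s ∈ {s | 0 < q s}, 2 * q s ≠ 0 := fun s (hs : 0 < q s) => by positivity
    refine p_smooth.contDiffOn.div ((contDiff_const.mul q_smooth).contDiffOn.sqrt hpos) ?_
    exact fun s (hs : 0 < q s) => (Real.sqrt_pos.2 (by positivity)).ne'
  · simpa [p_zero, q_zero] using hg 0 (by rw [q_zero]; norm_num)
  · filter_upwards [hU0] with s (hs : 0 < q s)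
    rw [mul_pow, Real.sq_sqrt (by positivity), f_eq]
    ring

lemma exists_reflection {f f₁ f₂ : ℝ → ℝ} (hf : ∀ s, HasDerivAt f (f₁ s) s)
    (hf₁ : ∀ s, HasDerivAt f₁ (f₂ s) s) (hf₂ : ContDiff ℝ 5 f₂)
    (f_zero : f 0 = 0) (f₁_zero : f₁ 0 = 0) (f₂_zero : f₂ 0 = 1) :
    ∃ φ : ℝ → ℝ, ContDiffAt ℝ 6 φ 0 ∧ φ 0 = 0 ∧ HasDerivAt φ 1 0 ∧
      ∀ᶠ ε in 𝓝 0, f (φ ε) = f (-ε) := by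
  obtain ⟨g, g_smooth, g_zero, g_deriv, hgf⟩ :=
    exists_sqrt_chart hf hf₁ hf₂ f_zero f₁_zero f₂_zero
  have hg' : HasFDerivAt g (ContinuousLinearEquiv.refl ℝ ℝ : ℝ →L[ℝ] ℝ) 0 := by
    convert! g_deriv.hasFDerivAt using 1
    ext; simp
  have h6 : (6 : WithTop ℕ∞) ≠ 0 := by norm_num
  set L := g_smooth.localInverse hg' h6
  have L_smooth : ContDiffAt ℝ 6 L 0 := by
    simpa [g_zero] using g_smooth.to_localInverse hg' h6
  have L_zero : L 0 = 0 := by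
    simpa [g_zero] using g_smooth.localInverse_apply_image hg' h6
  have hL : ∀ᶠ y in 𝓝 0, g (L y) = y := by
    have h := (g_smooth.hasStrictFDerivAt' hg' h6).eventually_right_inverse
    rwa [g_zero] at h
  have h_smooth : ContDiffAt ℝ 6 (fun ε => -g (-ε)) 0 :=
    (ContDiffAt.comp (0 : ℝ) (g := g) (f := fun ε : ℝ => -ε) (by simpa using g_smooth)
      contDiffAt_id.neg).neg
  have h_zero : -g (-0) = 0 := by simp [g_zero]
  have h_tendsto : Tendsto (fun ε => -g (-ε)) (𝓝 0) (𝓝 0) := by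
    simpa [g_zero] using h_smooth.continuousAt.tendsto
  have φ_smooth : ContDiffAt ℝ 6 (fun ε => L (-g (-ε))) 0 :=
    ContDiffAt.comp (0 : ℝ) (g := L) (by rwa [h_zero]) h_smooth
  have φ_zero : L (-g (-0)) = 0 := by rw [h_zero, L_zero]
  have hgφ : ∀ᶠ ε in 𝓝 0, g (L (-g (-ε))) = -g (-ε) := h_tendsto.eventually hL
  have φ_tendsto : Tendsto (fun ε => L (-g (-ε))) (𝓝 0) (𝓝 0) := by
    simpa [g_zero, L_zero] using φ_smooth.continuousAt.tendsto
  refine ⟨fun ε => L (-g (-ε)), φ_smooth, φ_zero, ?_, ?_⟩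
  · have hd := (φ_smooth.differentiableAt h6).hasDerivAt
    have hcomp := HasDerivAt.comp (0 : ℝ) (h₂ := g) (by rw [φ_zero]; exact g_deriv) hd
    have hneg : HasDerivAt (fun ε => -g (-ε)) 1 0 := by
      convert! (HasDerivAt.comp (0 : ℝ) (h₂ := g) (h := fun ε : ℝ => -ε)
        (by simpa using g_deriv) (hasDerivAt_id (0 : ℝ)).neg).neg using 1
      simp
    have := hcomp.unique (hneg.congr_of_eventuallyEq hgφ)
    rw [one_mul] at this
    rwa [this] at hd
  · have hneg : Tendsto (fun ε : ℝ => -ε) (𝓝 0) (𝓝 0) := by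
      simpa using (continuous_neg (G := ℝ)).tendsto 0
    filter_upwards [hgφ, φ_tendsto.eventually hgf, hneg.eventually hgf] with ε h1 h2 h3
    rw [h1] at h2
    linarith [neg_sq (g (-ε))]

lemma isBigO_pow_succ_of_hasDerivAt {R R' : ℝ → ℝ} {n : ℕ} (hR : ∀ s, HasDerivAt R (R' s) s)
    (R_zero : R 0 = 0) (hR' : R' =O[𝓝 0] fun s => s ^ n) : R =O[𝓝 0] fun s => s ^ (n + 1) := by
  obtain ⟨C, hC, hb⟩ := hR'.exists_nonneg
  obtain ⟨r, hr, hball⟩ := Metric.eventually_nhds_iff_ball.1 hb.bound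
  refine IsBigO.of_bound C ?_
  filter_upwards [Metric.ball_mem_nhds (0 : ℝ) hr] with s hs
  have hs' : |s| < r := by simpa using hs
  have h := (convex_closedBall (0 : ℝ) |s|).norm_image_sub_le_of_norm_hasDerivWithin_le
    (f := R) (f' := R') (C := C * |s| ^ n) (x := 0) (y := s)
    (fun x _ => (hR x).hasDerivWithinAt) (fun x hx => ?_) (by simp) (by simp)
  · simpa [R_zero, pow_succ, mul_assoc] using h
  · have hx' : |x| ≤ |s| := by simpa using hx
    refine (hball x (by simpa using hx'.trans_lt hs')).trans ?_
    rw [norm_pow, Real.norm_eq_abs]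
    gcongr

lemma pow_isBigO_pow_nhds_zero {m n : ℕ} (h : n ≤ m) :
    (fun s : ℝ => s ^ m) =O[𝓝 0] fun s => s ^ n := by
  obtain ⟨d, rfl⟩ := Nat.exists_eq_add_of_le h
  have hc : (fun s : ℝ => s ^ d) =O[𝓝 0] fun _ => (1 : ℝ) :=
    ((continuous_pow d).tendsto (0 : ℝ)).isBigO_one ℝ
  simpa [pow_add] using (isBigO_refl (fun s : ℝ => s ^ n) (𝓝 0)).mul hc

lemma taylor_two_isBigO {κ : ℝ → ℝ} (hκ : ContDiff ℝ 3 κ) :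
    ∃ c : ℝ, (fun s => κ s - κ 0 - deriv κ 0 * s - c * s ^ 2) =O[𝓝 0] fun s => s ^ 3 := by
  have hκ' : ContDiff ℝ 2 (deriv κ) := hκ.deriv'
  have hκ'' : ContDiff ℝ 1 (deriv (deriv κ)) := hκ'.deriv'
  have h0 (s : ℝ) : HasDerivAt κ (deriv κ s) s := (hκ.differentiable (by norm_num) s).hasDerivAt
  have h1 (s : ℝ) : HasDerivAt (deriv κ) (deriv (deriv κ) s) s :=
    (hκ'.differentiable (by norm_num) s).hasDerivAt
  have h2 : (fun s => deriv (deriv κ) s - deriv (deriv κ) 0) =O[𝓝 0] fun s => s ^ 1 := by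
    simpa using (hκ''.differentiable one_ne_zero 0).isBigO_sub
  refine ⟨deriv (deriv κ) 0 / 2, isBigO_pow_succ_of_hasDerivAt (fun s => ?_) (by simp)
    (isBigO_pow_succ_of_hasDerivAt (R := fun s => deriv κ s - deriv κ 0 - deriv (deriv κ) 0 * s)
      (fun s => ?_) (by simp) h2)⟩
  · convert! (((h0 s).sub_const (κ 0)).sub ((hasDerivAt_id s).const_mul (deriv κ 0))).sub
      ((hasDerivAt_pow 2 s).const_mul (deriv (deriv κ) 0 / 2)) using 1
    push_cast; ring
  · convert! ((h1 s).sub_const (deriv κ 0)).sub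
      ((hasDerivAt_id s).const_mul (deriv (deriv κ) 0)) using 1
    ring

/-- Sixth order Taylor expansion at `0` of a function `f` with `f''' = -κ f'` and
`f = f' = 0`, `f'' = 1` at `0`. -/
lemma taylor_six_isBigO {f f₁ f₂ κ : ℝ → ℝ} (hf : ∀ s, HasDerivAt f (f₁ s) s)
    (hf₁ : ∀ s, HasDerivAt f₁ (f₂ s) s) (hf₂ : ∀ s, HasDerivAt f₂ (-κ s * f₁ s) s)
    (hκ : ContDiff ℝ 3 κ) (f_zero : f 0 = 0) (f₁_zero : f₁ 0 = 0) (f₂_zero : f₂ 0 = 1) :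
    ∃ c : ℝ, (fun s => f s - (s ^ 2 / 2 - κ 0 * s ^ 4 / 24 - deriv κ 0 * s ^ 5 / 60 + c * s ^ 6))
      =O[𝓝 0] fun s => s ^ 7 := by
  have hf₁_one : f₁ =O[𝓝 0] fun s => s ^ 1 := by
    simpa [f₁_zero] using (hf₁ 0).differentiableAt.isBigO_sub
  have hκ_one : κ =O[𝓝 0] fun s => s ^ 0 := by
    simpa using (hκ.continuous.tendsto 0).isBigO_one ℝ
  have hκ_lip : (fun s => κ s - κ 0) =O[𝓝 0] fun s => s ^ 1 := by
    simpa using (hκ.differentiable (by norm_num) 0).isBigO_sub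
  obtain ⟨a, ha⟩ := taylor_two_isBigO hκ
  have hmul {u v : ℝ → ℝ} {m n : ℕ} (hu : u =O[𝓝 0] fun s => s ^ m)
      (hv : v =O[𝓝 0] fun s => s ^ n) : (fun s => u s * v s) =O[𝓝 0] fun s => s ^ (m + n) := by
    simpa only [pow_add] using hu.mul hv
  have hf₂_two : (fun s => f₂ s - 1) =O[𝓝 0] fun s => s ^ 2 :=
    isBigO_pow_succ_of_hasDerivAt (fun s => (hf₂ s).sub_const 1) (by simp [f₂_zero])
      (by simpa [neg_mul] using (hmul hκ_one hf₁_one).neg_left)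
  have hf₁_three : (fun s => f₁ s - s) =O[𝓝 0] fun s => s ^ 3 :=
    isBigO_pow_succ_of_hasDerivAt (fun s => (hf₁ s).sub (hasDerivAt_id s)) (by simp [f₁_zero])
      hf₂_two
  have hf₂_three : (fun s => f₂ s - (1 - κ 0 * s ^ 2 / 2)) =O[𝓝 0] fun s => s ^ 3 := by
    refine isBigO_pow_succ_of_hasDerivAt (n := 2)
      (R' := fun s => -(κ s * (f₁ s - s)) - (κ s - κ 0) * s ^ 1) (fun s => ?_) (by simp [f₂_zero])
      (((hmul hκ_one hf₁_three).trans (pow_isBigO_pow_nhds_zero (by norm_num))).neg_left.sub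
        (hmul hκ_lip (isBigO_refl _ _)))
    convert! (hf₂ s).sub ((((hasDerivAt_pow 2 s).const_mul (κ 0)).div_const 2).const_sub 1) using 1
    push_cast; ring
  have hf₁_four : (fun s => f₁ s - (s - κ 0 * s ^ 3 / 6)) =O[𝓝 0] fun s => s ^ 4 := by
    refine isBigO_pow_succ_of_hasDerivAt (fun s => ?_) (by simp [f₁_zero]) hf₂_three
    convert! (hf₁ s).sub ((hasDerivAt_id s).sub
      (((hasDerivAt_pow 3 s).const_mul (κ 0)).div_const 6)) using 1
    push_cast; ring
  have hf₂_five : (fun s => f₂ s - (1 - κ 0 * s ^ 2 / 2 - deriv κ 0 * s ^ 3 / 3 -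
      (a - κ 0 ^ 2 / 6) * s ^ 4 / 4)) =O[𝓝 0] fun s => s ^ 5 := by
    refine isBigO_pow_succ_of_hasDerivAt (n := 4)
      (R' := fun s => -((κ s - κ 0 - deriv κ 0 * s - a * s ^ 2) * f₁ s)
        - κ 0 * (f₁ s - (s - κ 0 * s ^ 3 / 6))
        - deriv κ 0 * (s ^ 1 * (f₁ s - s))
        - a * (s ^ 2 * (f₁ s - s)))
      (fun s => ?_) (by simp [f₂_zero])
      ((((hmul ha hf₁_one).neg_left.sub (hf₁_four.const_mul_left _)).sub
        ((hmul (isBigO_refl _ _) hf₁_three).const_mul_left _)).sub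
        (((hmul (isBigO_refl _ _) hf₁_three).trans
          (pow_isBigO_pow_nhds_zero (by norm_num))).const_mul_left _))
    convert! (hf₂ s).sub ((((((hasDerivAt_pow 2 s).const_mul (κ 0)).div_const 2).const_sub 1).sub
      (((hasDerivAt_pow 3 s).const_mul (deriv κ 0)).div_const 3)).sub
      (((hasDerivAt_pow 4 s).const_mul (a - κ 0 ^ 2 / 6)).div_const 4)) using 1
    push_cast; ring
  have hf₁_six : (fun s => f₁ s - (s - κ 0 * s ^ 3 / 6 - deriv κ 0 * s ^ 4 / 12 -
      (a - κ 0 ^ 2 / 6) * s ^ 5 / 20)) =O[𝓝 0] fun s => s ^ 6 := by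
    refine isBigO_pow_succ_of_hasDerivAt (fun s => ?_) (by simp [f₁_zero]) hf₂_five
    convert! (hf₁ s).sub ((((hasDerivAt_id s).sub
      (((hasDerivAt_pow 3 s).const_mul (κ 0)).div_const 6)).sub
      (((hasDerivAt_pow 4 s).const_mul (deriv κ 0)).div_const 12)).sub
      (((hasDerivAt_pow 5 s).const_mul (a - κ 0 ^ 2 / 6)).div_const 20)) using 1
    push_cast; ring
  refine ⟨-(a - κ 0 ^ 2 / 6) / 120, ?_⟩
  refine isBigO_pow_succ_of_hasDerivAt (fun s => ?_) (by simp [f_zero]) hf₁_six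
  convert! (hf s).sub ((((((hasDerivAt_pow 2 s).div_const 2)).sub
    (((hasDerivAt_pow 4 s).const_mul (κ 0)).div_const 24)).sub
    (((hasDerivAt_pow 5 s).const_mul (deriv κ 0)).div_const 60)).add
    ((hasDerivAt_pow 6 s).const_mul (-(a - κ 0 ^ 2 / 6) / 120))) using 1
  push_cast; ring

/-- If `f s = s²/2 + b s⁴ - β s⁵ + c s⁶ + O(s⁷)` and `f (φ ε) = f (-ε)` with `φ ε ~ ε`, then
`φ ε = ε + 2β ε⁴ + O(ε⁶)`. -/
lemma reflection_expansion {f φ : ℝ → ℝ} {b β c : ℝ}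
    (hf : (fun s => f s - (s ^ 2 / 2 + b * s ^ 4 - β * s ^ 5 + c * s ^ 6)) =O[𝓝 0]
      fun s => s ^ 7)
    (φ_zero : φ 0 = 0) (φ_deriv : HasDerivAt φ 1 0) (hφ : ∀ᶠ ε in 𝓝 0, f (φ ε) = f (-ε)) :
    (fun ε => φ ε - ε - 2 * β * ε ^ 4) =O[𝓝[>] 0] fun ε => ε ^ 6 := by
  have hmul {u v : ℝ → ℝ} {m n : ℕ} (hu : u =O[𝓝 0] fun s => s ^ m)
      (hv : v =O[𝓝 0] fun s => s ^ n) : (fun s => u s * v s) =O[𝓝 0] fun s => s ^ (m + n) := by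
    simpa only [pow_add] using hu.mul hv
  have hdiv {u : ℝ → ℝ} {n : ℕ} (hu : (fun ε => ε * u ε) =O[𝓝[>] 0] fun ε => ε ^ (n + 1)) :
      u =O[𝓝[>] 0] fun ε => ε ^ n := by
    have h := (isBigO_refl (fun ε : ℝ => ε⁻¹) (𝓝[>] 0)).mul hu
    have hne : ∀ᶠ ε : ℝ in 𝓝[>] 0, ε ≠ 0 := by
      filter_upwards [self_mem_nhdsWithin] with ε hε using ne_of_gt hε
    refine h.congr' ?_ ?_
    · filter_upwards [hne] with ε hε
      field_simp
    · filter_upwards [hne] with ε hε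
      rw [pow_succ']
      field_simp
  have φ_tendsto : Tendsto φ (𝓝 0) (𝓝 0) := by simpa [φ_zero] using φ_deriv.continuousAt.tendsto
  have hneg : Tendsto (fun ε : ℝ => -ε) (𝓝 0) (𝓝 0) := by
    simpa using (continuous_neg (G := ℝ)).tendsto 0
  have hφ1 : φ =O[𝓝 0] fun ε => ε ^ 1 := by
    simpa [φ_zero] using φ_deriv.differentiableAt.isBigO_sub
  have hd_o : (fun ε => φ ε - ε) =o[𝓝 0] fun ε => ε := by
    simpa [φ_zero] using φ_deriv.isLittleO
  have hε1 : (fun ε : ℝ => ε) =O[𝓝 0] fun ε => ε ^ 1 := by simpa using isBigO_refl _ _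
  have hR1 := (hf.comp_tendsto φ_tendsto).trans
    (by simpa [Function.comp_def] using hφ1.pow 7 : ((fun s : ℝ => s ^ 7) ∘ φ) =O[𝓝 0] fun ε => ε ^ 7)
  have hR2 := (hf.comp_tendsto hneg).trans
    (isBigO_of_le _ fun ε => by simp :
      ((fun s : ℝ => s ^ 7) ∘ fun ε : ℝ => -ε) =O[𝓝 0] fun ε => ε ^ 7)
  set A : ℝ → ℝ := fun ε => b * ((φ ε + ε) * (φ ε ^ 2 + ε ^ 2)) +
    c * ((φ ε + ε) * (φ ε ^ 4 + φ ε ^ 2 * ε ^ 2 + ε ^ 4)) with hA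
  have hsum : (fun ε => φ ε + ε) =O[𝓝 0] fun ε => ε ^ 1 := hφ1.add hε1
  have hsq : (fun ε => φ ε ^ 2 + ε ^ 2) =O[𝓝 0] fun ε => ε ^ 2 := by
    simpa using (hφ1.pow 2).add (hε1.pow 2)
  have hA3 : A =O[𝓝 0] fun ε => ε ^ 3 := by
    have h4 : (fun ε => φ ε ^ 4 + φ ε ^ 2 * ε ^ 2 + ε ^ 4) =O[𝓝 0] fun ε => ε ^ 4 := by
      refine IsBigO.add (IsBigO.add ?_ ?_) (isBigO_refl _ _)
      · simpa using hφ1.pow 4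
      · exact hmul (m := 2) (n := 2) (by simpa using hφ1.pow 2) (isBigO_refl _ _)
    exact ((hmul hsum hsq).const_mul_left b).add
      (((hmul hsum h4).trans (pow_isBigO_pow_nhds_zero (by norm_num))).const_mul_left c)
  have key : (fun ε => (φ ε - ε) * ((φ ε + ε) / 2 + A ε) - β * (φ ε ^ 5 + ε ^ 5)) =O[𝓝 0]
      fun ε => ε ^ 7 := by
    refine (hR2.sub hR1).congr' ?_ EventuallyEq.rfl
    filter_upwards [hφ] with ε hε
    simp only [Function.comp, hε, hA]
    ring
  have hfive : (fun ε => φ ε ^ 5 + ε ^ 5) =O[𝓝 0] fun ε => ε ^ 5 := by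
    simpa using (hφ1.pow 5).add (hε1.pow 5)
  have hprod : (fun ε => (φ ε - ε) * ((φ ε + ε) / 2 + A ε)) =O[𝓝 0] fun ε => ε ^ 5 := by
    simpa using (key.trans (pow_isBigO_pow_nhds_zero (by norm_num : 5 ≤ 7))).add
      (hfive.const_mul_left β)
  have hA_o : A =o[𝓝 0] fun ε => ε := by
    refine hA3.trans_isLittleO ?_
    simpa using isLittleO_pow_pow (𝕜 := ℝ) (m := 1) (n := 3) (by norm_num)
  have hequiv : (fun ε => (φ ε + ε) / 2 + A ε) ~[𝓝 0] fun ε => ε := by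
    refine ((hd_o.const_mul_left (1 / 2)).add hA_o).congr_left fun ε => ?_
    simp only [Pi.sub_apply]
    ring
  have hd4 : (fun ε => φ ε - ε) =O[𝓝[>] 0] fun ε => ε ^ 4 := by
    refine hdiv (IsBigO.mono ?_ nhdsWithin_le_nhds)
    refine (hequiv.isBigO_symm.mul (isBigO_refl (fun ε => φ ε - ε) _)).trans ?_
    exact hprod.congr_left fun ε => mul_comm _ _
  refine hdiv ?_
  have hmul' {u v : ℝ → ℝ} {m n : ℕ} (hu : u =O[𝓝[>] 0] fun s => s ^ m)
      (hv : v =O[𝓝 0] fun s => s ^ n) (hmn : 7 ≤ m + n) :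
      (fun s => u s * v s) =O[𝓝[>] 0] fun s => s ^ 7 := by
    have h := hu.mul (hv.mono (nhdsWithin_le_nhds (s := Set.Ioi (0 : ℝ))))
    simp only [← pow_add] at h
    exact h.trans ((pow_isBigO_pow_nhds_zero hmn).mono nhdsWithin_le_nhds)
  have hd1 : (fun ε => φ ε - ε) =O[𝓝 0] fun ε => ε ^ 1 := hφ1.sub hε1
  have hdd : (fun ε => (φ ε - ε) * (φ ε - ε)) =O[𝓝[>] 0] fun ε => ε ^ 7 := by
    have h := hd4.mul hd4
    simp only [← pow_add] at h
    exact h.trans ((pow_isBigO_pow_nhds_zero (by norm_num)).mono nhdsWithin_le_nhds)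
  have hquartic : (fun ε => φ ε ^ 4 + φ ε ^ 3 * ε + φ ε ^ 2 * ε ^ 2 + φ ε * ε ^ 3 + ε ^ 4)
      =O[𝓝 0] fun ε => ε ^ 4 := by
    have h (n : ℕ) : (fun ε => φ ε ^ n) =O[𝓝 0] fun ε => ε ^ n := by simpa using hφ1.pow n
    exact ((((h 4).add (hmul (m := 3) (n := 1) (h 3) hε1)).add
      (hmul (m := 2) (n := 2) (h 2) (isBigO_refl _ _))).add
      (hmul (m := 1) (n := 3) hφ1 (isBigO_refl _ _))).add (isBigO_refl _ _)
  refine ((((key.mono nhdsWithin_le_nhds).sub (hdd.const_mul_left (1 / 2))).sub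
    (hmul' hd4 hA3 le_rfl)).add
    ((hmul' hd4 hquartic (by norm_num)).const_mul_left β)).congr_left fun ε => ?_
  ring

lemma HasDerivAt.omega_right {c : ℝ → EuclideanSpace ℝ (Fin 2)} {c' : EuclideanSpace ℝ (Fin 2)}
    {s : ℝ} (hc : HasDerivAt c c' s) (v : EuclideanSpace ℝ (Fin 2)) :
    HasDerivAt (fun s => omega v (c s)) (omega v c') s := by
  have h (i : Fin 2) : HasDerivAt (fun s => c s i) (c' i) s :=
    (EuclideanSpace.proj (𝕜 := ℝ) i).hasFDerivAt.comp_hasDerivAt s hc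
  exact ((h 1).const_mul (v 0)).sub ((h 0).const_mul (v 1))

lemma ContDiff.omega_right {c : ℝ → EuclideanSpace ℝ (Fin 2)} {n : WithTop ℕ∞}
    (hc : ContDiff ℝ n c) (v : EuclideanSpace ℝ (Fin 2)) :
    ContDiff ℝ n fun s => omega v (c s) := by
  have h (i : Fin 2) : ContDiff ℝ n fun s => c s i :=
    (EuclideanSpace.proj (𝕜 := ℝ) i).contDiff.comp hc
  exact (contDiff_const.mul (h 1)).sub (contDiff_const.mul (h 0))

/-- Lazutkin-type expansion of the symplectic billiard map:
`ε₁ = ε + (1/30) k'(t₁) ε⁴ + O(ε⁶)` (Proposition C.1). -/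
theorem symplectic_billiard_lazutkin_expansion (γ : ℝ → EuclideanSpace ℝ (Fin 2))
    (hγ : ContDiff ℝ 7 γ)
    (hper : ∀ t, γ (t + 1) = γ t)
    (haff : ∀ t, omega (deriv γ t) (deriv (deriv γ) t) = 1)
    (k : ℝ → ℝ) (hk : ContDiff ℝ 4 k)
    (hode : ∀ t, iteratedDeriv 3 γ t = -(k t) • deriv γ t)
    (t₁ : ℝ) :
    ∃ δ > (0 : ℝ), ∃ C > (0 : ℝ), ∃ φ : ℝ → ℝ,
      ContDiffOn ℝ 6 φ (Set.Ioo (-δ) δ) ∧ φ 0 = 0 ∧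
      ∀ ε ∈ Set.Ioo (0 : ℝ) δ,
        omega (γ (t₁ + φ ε) - γ (t₁ - ε)) (deriv γ t₁) = 0 ∧
        |φ ε - ε - (1 / 30) * deriv k t₁ * ε ^ 4| ≤ C * ε ^ 6 := by
  have hγ₁ : ContDiff ℝ 6 (deriv γ) := hγ.deriv'
  have hγ₂ : ContDiff ℝ 5 (deriv (deriv γ)) := hγ₁.deriv'
  have hode' (t : ℝ) : deriv (deriv (deriv γ)) t = -(k t) • deriv γ t := by
    rw [← hode, iteratedDeriv_succ, iteratedDeriv_succ, iteratedDeriv_one]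
  set v := deriv γ t₁ with hv
  have hd {c : ℝ → EuclideanSpace ℝ (Fin 2)} (hc : Differentiable ℝ c) (s : ℝ) :
      HasDerivAt (fun s => omega v (c (t₁ + s))) (omega v (deriv c (t₁ + s))) s :=
    ((hc (t₁ + s)).hasDerivAt.comp_const_add t₁ s).omega_right v
  have hf (s : ℝ) : HasDerivAt (fun s => omega v (γ (t₁ + s)) - omega v (γ t₁))
      (omega v (deriv γ (t₁ + s))) s :=
    (hd (hγ.differentiable (by norm_num)) s).sub_const _
  have hf₁ := hd (hγ₁.differentiable (by norm_num))
  have hf₂ (s : ℝ) : HasDerivAt (fun s => omega v (deriv (deriv γ) (t₁ + s)))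
      (-k (t₁ + s) * omega v (deriv γ (t₁ + s))) s := by
    convert! hd (hγ₂.differentiable (by norm_num)) s using 1
    simp only [hode', omega, PiLp.smul_apply, smul_eq_mul]
    ring
  have f_zero : omega v (γ (t₁ + 0)) - omega v (γ t₁) = 0 := by simp
  have f₁_zero : omega v (deriv γ (t₁ + 0)) = 0 := by
    simp only [add_zero, ← hv, omega]
    ring
  have f₂_zero : omega v (deriv (deriv γ) (t₁ + 0)) = 1 := by simp [hv, haff]
  have hκ : ContDiff ℝ 3 fun s => k (t₁ + s) :=
    (hk.of_le (by norm_num)).comp (contDiff_const.add contDiff_id)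
  obtain ⟨φ, φ_smooth, φ_zero, φ_deriv, hφ⟩ := exists_reflection hf hf₁
    ((hγ₂.comp (contDiff_const.add contDiff_id)).omega_right v) f_zero f₁_zero f₂_zero
  obtain ⟨c, hc⟩ := taylor_six_isBigO hf hf₁ hf₂ hκ f_zero f₁_zero f₂_zero
  have hexp := reflection_expansion (f := fun s => omega v (γ (t₁ + s)) - omega v (γ t₁))
    (b := -k (t₁ + 0) / 24) (β := deriv (fun s => k (t₁ + s)) 0 / 60) (c := c)
    (hc.congr_left fun s => by ring) φ_zero φ_deriv hφ
  simp only [deriv_comp_const_add, add_zero] at hexp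
  obtain ⟨C, C_pos, hC⟩ := hexp.exists_pos
  obtain ⟨u, hu, φ_on⟩ := φ_smooth.contDiffOn le_rfl (by simp)
  have hu : u ∈ 𝓝 (0 : ℝ) := by simpa using hu
  obtain ⟨δ, δ_pos, hδ⟩ := Metric.eventually_nhds_iff_ball.1
    ((eventually_mem_nhds_iff.2 hu).and (hφ.and (eventually_nhdsWithin_iff.1 hC.bound)))
  simp only [Real.ball_eq_Ioo, zero_sub, zero_add] at hδ
  refine ⟨δ, δ_pos, C, C_pos, φ, φ_on.mono fun ε hε => mem_of_mem_nhds (hδ ε hε).1, φ_zero,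
    fun ε hε => ?_⟩
  obtain ⟨-, hε_eq, hε_bound⟩ := hδ ε ⟨by linarith [hε.1], hε.2⟩
  constructor
  · simp only [omega, PiLp.sub_apply, sub_eq_add_neg t₁ ε] at hε_eq ⊢
    linarith
  · have h := hε_bound hε.1
    rw [Real.norm_eq_abs, Real.norm_of_nonneg (pow_nonneg hε.1.le 6)] at h
    convert! h using 2
    ring
end

section
/- Let M ≥ 1 be a real number and let q be a positive integer with q ≥ e^{3/2}·M². Let ε₀, ε₁, …, ε_{q−1} be positive real numbers such that ε₀ ≤ 1/q and |ε_{k+1} − ε_k| ≤ M·ε_k⁴ for all 0 ≤ k ≤ q−2. Then for every k ∈ {0, …, q−1}, ε_k ≤ (M/q)·(1 + 1/q)^k; in particular ε_k ≤ e·M/q for all k. -/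
theorem one_add_inv_pow_le_exp_one {q k : ℕ} (hq : 0 < q) (hk : k ≤ q) :
    (1 + 1 / (q : ℝ)) ^ k ≤ Real.exp 1 := by
  have hq' : (0 : ℝ) < q := by exact_mod_cast hq
  have hkq : (k : ℝ) ≤ q := by exact_mod_cast hk
  calc (1 + 1 / (q : ℝ)) ^ k ≤ Real.exp (1 / q) ^ k := by
        gcongr
        linarith [Real.add_one_le_exp (1 / (q : ℝ))]
    _ = Real.exp (k * (1 / q)) := (Real.exp_nat_mul _ _).symm
    _ ≤ Real.exp 1 := by
        gcongr
        rw [mul_one_div]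
        exact (div_le_one hq').2 hkq

theorem mul_exp_mul_div_cube_le_one_div {M q : ℝ} (hq0 : 0 < q)
    (hq : Real.exp (3 / 2) * M ^ 2 ≤ q) :
    M * (Real.exp 1 * M / q) ^ 3 ≤ 1 / q := by
  have hexp : Real.exp (3 / 2) ^ 2 = Real.exp 1 ^ 3 := by
    rw [← Real.exp_nat_mul, ← Real.exp_nat_mul]
    norm_num
  have hsq : (Real.exp (3 / 2) * M ^ 2) ^ 2 ≤ q ^ 2 := by gcongr
  calc M * (Real.exp 1 * M / q) ^ 3 = (Real.exp (3 / 2) * M ^ 2) ^ 2 / q ^ 3 := by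
        rw [mul_pow, hexp]
        ring
    _ ≤ q ^ 2 / q ^ 3 := by gcongr
    _ = 1 / q := by field_simp

/-- A-priori bound on the parameter gaps of a maximal `q`-periodic symplectic billiard
orbit (Lemma C.4). -/
theorem gap_bound (M : ℝ) (hM : 1 ≤ M) (q : ℕ) (hq0 : 0 < q)
    (hq : Real.exp (3 / 2) * M ^ 2 ≤ (q : ℝ))
    (ε : ℕ → ℝ) (hpos : ∀ k < q, 0 < ε k) (h0 : ε 0 ≤ 1 / q)
    (hstep : ∀ k, k + 2 ≤ q → |ε (k + 1) - ε k| ≤ M * ε k ^ 4) :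
    (∀ k < q, ε k ≤ M / q * (1 + 1 / q) ^ k) ∧
      ∀ k < q, ε k ≤ Real.exp 1 * M / q := by
  have hq' : (0 : ℝ) < q := by exact_mod_cast hq0
  have hweak : ∀ k < q, M / q * (1 + 1 / (q : ℝ)) ^ k ≤ Real.exp 1 * M / q := fun k hk =>
    calc M / q * (1 + 1 / (q : ℝ)) ^ k ≤ M / q * Real.exp 1 := by
          gcongr
          exact one_add_inv_pow_le_exp_one hq0 hk.le
      _ = Real.exp 1 * M / q := by ring
  have hmain : ∀ k < q, ε k ≤ M / q * (1 + 1 / q) ^ k := by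
    intro k
    induction k with
    | zero =>
      intro _
      rw [pow_zero, mul_one]
      exact h0.trans (by gcongr)
    | succ k ih =>
      intro hk
      have hkq : k < q := by omega
      have hε := hpos k hkq
      have hεe := (ih hkq).trans (hweak k hkq)
      have hcube : M * ε k ^ 3 ≤ 1 / q :=
        (by gcongr : M * ε k ^ 3 ≤ M * (Real.exp 1 * M / q) ^ 3).trans
          (mul_exp_mul_div_cube_le_one_div hq' hq)
      calc ε (k + 1) ≤ ε k + M * ε k ^ 4 := by
            linarith [(abs_le.1 (hstep k (by omega))).2]
        _ = ε k * (1 + M * ε k ^ 3) := by ring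
        _ ≤ M / q * (1 + 1 / q) ^ k * (1 + 1 / q) := by
            gcongr
            exact ih hkq
        _ = M / q * (1 + 1 / q) ^ (k + 1) := by ring
  exact ⟨hmain, fun k hk => (hmain k hk).trans (hweak k hk)⟩
end
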